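/- Let f : ℝ^k → ℝ be continuous with |f(x)| ≤ a + K·φ(|x|) for all x, where a ≥ 0, K > 0 are constants and φ : [0,∞) → [0,∞) is a strictly increasing convex function with φ(0) = 0 and φ continuous at 0. For n ≥ 1 define f_n(x) = inf { f(u) + (n/2)·K·φ(2|u − x|) : u ∈ ℚ^k }. Then f_n converges to f continuously: for every x ∈ ℝ^k and every sequence (x_n) in ℝ^k with x_n → x, one has f_n(x_n) → f(x) as n → ∞. In particular, f_n(x) → f(x) pointwise for every x. -/

import Mathlib

open Filter

/-- The set of points of `ℝ^k` with rational coordinates. -/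
def ratPoints (k : ℕ) : Set (EuclideanSpace ℝ (Fin k)) :=
  {u | ∀ i, ∃ r : ℚ, u i = (r : ℝ)}

/-- The approximating infimal convolution `f_n`. -/
noncomputable def lowerApprox {k : ℕ} (f : EuclideanSpace ℝ (Fin k) → ℝ)
    (K : ℝ) (φ : ℝ → ℝ) (n : ℕ) (x : EuclideanSpace ℝ (Fin k)) : ℝ :=
  sInf ((fun u => f u + ((n : ℝ) / 2) * K * φ (2 * ‖u - x‖)) '' ratPoints k)

theorem dense_ratPoints (k : ℕ) : Dense (ratPoints k) := by
  have h : DenseRange (WithLp.toLp 2 ∘ Pi.map (fun (_ : Fin k) (r : ℚ) => (r : ℝ))) :=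
    (WithLp.toLp_surjective 2).denseRange.comp
      (DenseRange.piMap fun _ => Rat.denseRange_cast) (PiLp.continuous_toLp 2 _)
  refine h.mono ?_
  rintro _ ⟨r, rfl⟩ i
  exact ⟨r i, rfl⟩

section

variable {k : ℕ} {f : EuclideanSpace ℝ (Fin k) → ℝ} {a K : ℝ} {φ : ℝ → ℝ}

/-- Midpoint convexity applied to the decomposition `u = (u - y) + y`. -/
theorem two_mul_apply_norm_le_of_convexOn (hφ_mono : StrictMonoOn φ (Set.Ici (0 : ℝ)))
    (hφ_conv : ConvexOn ℝ (Set.Ici (0 : ℝ)) φ) (u y : EuclideanSpace ℝ (Fin k)) :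
    2 * φ ‖u‖ ≤ φ (2 * ‖u - y‖) + φ (2 * ‖y‖) := by
  have htri : ‖u‖ ≤ ‖u - y‖ + ‖y‖ := by simpa using norm_add_le (u - y) y
  have hm : φ ‖u‖ ≤ φ (‖u - y‖ + ‖y‖) :=
    hφ_mono.monotoneOn (norm_nonneg u) (Set.mem_Ici.2 (by positivity)) htri
  have hd : 2 * ‖u - y‖ ∈ Set.Ici (0 : ℝ) := Set.mem_Ici.2 (by positivity)
  have hy : 2 * ‖y‖ ∈ Set.Ici (0 : ℝ) := Set.mem_Ici.2 (by positivity)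
  have hc := hφ_conv.2 hd hy (by norm_num : (0 : ℝ) ≤ 1 / 2) (by norm_num : (0 : ℝ) ≤ 1 / 2)
    (by norm_num)
  simp only [smul_eq_mul] at hc
  rw [show (1 / 2 : ℝ) * (2 * ‖u - y‖) + 1 / 2 * (2 * ‖y‖) = ‖u - y‖ + ‖y‖ by ring] at hc
  linarith

theorem le_add_penalty (hK : 0 < K) (hφ_mono : StrictMonoOn φ (Set.Ici (0 : ℝ)))
    (hφ_conv : ConvexOn ℝ (Set.Ici (0 : ℝ)) φ) (hbound : ∀ x, |f x| ≤ a + K * φ ‖x‖)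
    (n : ℕ) (u y : EuclideanSpace ℝ (Fin k)) :
    -a - K / 2 * φ (2 * ‖y‖) + ((n : ℝ) - 1) / 2 * K * φ (2 * ‖u - y‖) ≤
      f u + ((n : ℝ) / 2) * K * φ (2 * ‖u - y‖) := by
  have h := mul_le_mul_of_nonneg_left (two_mul_apply_norm_le_of_convexOn hφ_mono hφ_conv u y) hK.le
  linarith [(abs_le.1 (hbound u)).1]

theorem bddBelow_lowerApprox (hK : 0 < K)
    (hφ_nonneg : ∀ t ∈ Set.Ici (0 : ℝ), 0 ≤ φ t)
    (hφ_mono : StrictMonoOn φ (Set.Ici (0 : ℝ)))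
    (hφ_conv : ConvexOn ℝ (Set.Ici (0 : ℝ)) φ) (hbound : ∀ x, |f x| ≤ a + K * φ ‖x‖)
    {n : ℕ} (hn : 1 ≤ n) (y : EuclideanSpace ℝ (Fin k)) :
    BddBelow ((fun u => f u + ((n : ℝ) / 2) * K * φ (2 * ‖u - y‖)) '' ratPoints k) := by
  refine ⟨-a - K / 2 * φ (2 * ‖y‖), ?_⟩
  rintro _ ⟨u, -, rfl⟩
  have hn' : (0 : ℝ) ≤ ((n : ℝ) - 1) / 2 :=
    div_nonneg (sub_nonneg.2 (by exact_mod_cast hn)) zero_le_two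
  have hφ : 0 ≤ φ (2 * ‖u - y‖) := hφ_nonneg _ (Set.mem_Ici.2 (by positivity))
  have := mul_nonneg (mul_nonneg hn' hK.le) hφ
  exact le_trans (by linarith) (le_add_penalty hK hφ_mono hφ_conv hbound n u y)

theorem lowerApprox_le (hK : 0 < K)
    (hφ_nonneg : ∀ t ∈ Set.Ici (0 : ℝ), 0 ≤ φ t)
    (hφ_mono : StrictMonoOn φ (Set.Ici (0 : ℝ)))
    (hφ_conv : ConvexOn ℝ (Set.Ici (0 : ℝ)) φ) (hφ_zero : φ 0 = 0)
    (hφ_cont : ContinuousWithinAt φ (Set.Ici (0 : ℝ)) 0)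
    (hbound : ∀ x, |f x| ≤ a + K * φ ‖x‖)
    {n : ℕ} (hn : 1 ≤ n) (hf : Continuous f) (y : EuclideanSpace ℝ (Fin k)) :
    lowerApprox f K φ n y ≤ f y := by
  have hφt : Tendsto (fun u => φ (2 * ‖u - y‖)) (nhds y) (nhds 0) := by
    have hin : Tendsto (fun u => 2 * ‖u - y‖) (nhds y) (nhdsWithin 0 (Set.Ici 0)) := by
      refine tendsto_nhdsWithin_iff.2 ⟨?_, .of_forall fun u => Set.mem_Ici.2 (by positivity)⟩
      have h : Continuous fun u => 2 * ‖u - y‖ := by fun_prop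
      simpa using h.tendsto y
    simpa [hφ_zero, Function.comp_def] using hφ_cont.tendsto.comp hin
  have hlim : Tendsto (fun u => f u + ((n : ℝ) / 2) * K * φ (2 * ‖u - y‖))
      (nhdsWithin y (ratPoints k)) (nhds (f y)) := by
    simpa using ((hf.tendsto y).add (hφt.const_mul ((n : ℝ) / 2 * K))).mono_left
      nhdsWithin_le_nhds
  have : (nhdsWithin y (ratPoints k)).NeBot :=
    mem_closure_iff_nhdsWithin_neBot.1 (dense_ratPoints k y)
  refine ge_of_tendsto hlim ?_
  filter_upwards [self_mem_nhdsWithin] with u hu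
  exact csInf_le (bddBelow_lowerApprox hK hφ_nonneg hφ_mono hφ_conv hbound hn y)
    (Set.mem_image_of_mem _ hu)

theorem eventually_lt_lowerApprox (hK : 0 < K)
    (hφ_nonneg : ∀ t ∈ Set.Ici (0 : ℝ), 0 ≤ φ t)
    (hφ_mono : StrictMonoOn φ (Set.Ici (0 : ℝ)))
    (hφ_conv : ConvexOn ℝ (Set.Ici (0 : ℝ)) φ) (hφ_zero : φ 0 = 0)
    (hbound : ∀ x, |f x| ≤ a + K * φ ‖x‖) (hf : Continuous f)
    {x : EuclideanSpace ℝ (Fin k)} {xs : ℕ → EuclideanSpace ℝ (Fin k)}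
    (hxs : Tendsto xs atTop (nhds x)) {b : ℝ} (hb : b < f x) :
    ∀ᶠ n in atTop, b < lowerApprox f K φ n (xs n) := by
  obtain ⟨c, hbc, hcf⟩ := exists_between hb
  obtain ⟨δ, hδ, hball⟩ := Metric.eventually_nhds_iff.1 (hf.continuousAt.eventually_const_lt hcf)
  have hφδ : 0 < φ δ := hφ_zero ▸ hφ_mono Set.self_mem_Ici hδ.le hδ
  have hgrow : Tendsto (fun n : ℕ => -a - K / 2 * φ (2 * (‖x‖ + δ)) +
      ((n : ℝ) - 1) / 2 * K * φ δ) atTop atTop :=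
    tendsto_atTop_add_const_left _ _ <| Tendsto.atTop_mul_const hφδ <|
      Tendsto.atTop_mul_const hK <| Tendsto.atTop_div_const two_pos <|
      tendsto_atTop_add_const_right _ _ tendsto_natCast_atTop_atTop
  filter_upwards [hgrow.eventually_ge_atTop c, eventually_ge_atTop 1,
    Metric.tendsto_nhds.1 hxs (δ / 2) (half_pos hδ)] with n hc hn hx
  refine hbc.trans_le (le_csInf ((dense_ratPoints k).nonempty.image _) ?_)
  rintro _ ⟨u, -, rfl⟩
  have hφu : 0 ≤ φ (2 * ‖u - xs n‖) := hφ_nonneg _ (Set.mem_Ici.2 (by positivity))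
  rcases lt_or_ge ‖u - xs n‖ (δ / 2) with hu | hu
  · have hux : dist u x < δ := by
      rw [← dist_eq_norm] at hu
      linarith [dist_triangle u (xs n) x]
    have : 0 ≤ (n : ℝ) / 2 * K * φ (2 * ‖u - xs n‖) := by positivity
    linarith [hball hux]
  · refine hc.trans (le_trans ?_ (le_add_penalty hK hφ_mono hφ_conv hbound n u (xs n)))
    have hnorm : ‖xs n‖ ≤ ‖x‖ + δ := by
      rw [dist_eq_norm] at hx
      have := norm_add_le (xs n - x) x
      rw [sub_add_cancel] at this
      linarith
    have hn' : (0 : ℝ) ≤ (n : ℝ) - 1 := sub_nonneg.2 (by exact_mod_cast hn)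
    have h₁ : φ (2 * ‖xs n‖) ≤ φ (2 * (‖x‖ + δ)) :=
      hφ_mono.monotoneOn (Set.mem_Ici.2 (by positivity)) (Set.mem_Ici.2 (by positivity))
        (by linarith)
    have h₂ : φ δ ≤ φ (2 * ‖u - xs n‖) :=
      hφ_mono.monotoneOn hδ.le (Set.mem_Ici.2 (by positivity)) (by linarith)
    gcongr

end

/-- `f_n → f` continuously: for every `x` and every sequence
`x_n → x` one has `f_n (x_n) → f x`; in particular `f_n x → f x` pointwise. -/
theorem lowerApprox_tendsto
    (k : ℕ) (hk : 1 ≤ k)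
    (f : EuclideanSpace ℝ (Fin k) → ℝ) (hf : Continuous f)
    (a K : ℝ) (ha : 0 ≤ a) (hK : 0 < K)
    (φ : ℝ → ℝ)
    (hφ_nonneg : ∀ t ∈ Set.Ici (0 : ℝ), 0 ≤ φ t)
    (hφ_mono : StrictMonoOn φ (Set.Ici (0 : ℝ)))
    (hφ_conv : ConvexOn ℝ (Set.Ici (0 : ℝ)) φ)
    (hφ_zero : φ 0 = 0)
    (hφ_cont : ContinuousWithinAt φ (Set.Ici (0 : ℝ)) 0)
    (hbound : ∀ x, |f x| ≤ a + K * φ ‖x‖)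
    (x : EuclideanSpace ℝ (Fin k)) :
    (∀ xs : ℕ → EuclideanSpace ℝ (Fin k), Tendsto xs atTop (nhds x) →
      Tendsto (fun n => lowerApprox f K φ n (xs n)) atTop (nhds (f x))) ∧
    Tendsto (fun n => lowerApprox f K φ n x) atTop (nhds (f x)) := by
  have h : ∀ xs : ℕ → EuclideanSpace ℝ (Fin k), Tendsto xs atTop (nhds x) →
      Tendsto (fun n => lowerApprox f K φ n (xs n)) atTop (nhds (f x)) := by
    intro xs hxs
    refine tendsto_order.2 ⟨fun b hb => eventually_lt_lowerApprox hK hφ_nonneg hφ_mono hφ_conv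
      hφ_zero hbound hf hxs hb, fun b hb => ?_⟩
    filter_upwards [((hf.tendsto x).comp hxs).eventually_lt_const hb, eventually_ge_atTop 1]
      with n hfn hn
    exact (lowerApprox_le hK hφ_nonneg hφ_mono hφ_conv hφ_zero hφ_cont hbound hn hf
      (xs n)).trans_lt hfn
  exact ⟨h, h _ tendsto_const_nhds⟩
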